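/- Suppose μ(Ω) = ∞. Then there exists an increasing sequence (C_n)_{n≥0} of sets with C_0 = ∅, C_n ∈ ℛ for every n ≥ 1, μ(C_{n+1} \ C_n) ≥ 2^{n+1} for every n ≥ 0, and ⋃_n C_n = Ω. Consequently, the sets D_n := C_n \ C_{n−1} (n ≥ 1) belong to ℛ, are pairwise disjoint, satisfy μ(D_n) ≥ 2^n, and ⋃_{n≥1} D_n = Ω. -/

import Mathlib

open MeasureTheory Filter Set
open scoped ENNReal

/-- In a measure space with a countable generating ring `R` of sets of
finite measure covering `Ω`, if `μ Ω = ∞` then there is an increasing sequence `C`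
with `C 0 = ∅`, `C n ∈ R` for `n ≥ 1`, `μ (C (n+1) \ C n) ≥ 2^(n+1)` and `⋃ n, C n = Ω`;
consequently the sets `D n = C n \ C (n-1)` (for `n ≥ 1`) belong to `R`, are pairwise
disjoint, satisfy `μ (D n) ≥ 2^n`, and their union is `Ω`. -/
theorem statement0 {Ω : Type*} [m : MeasurableSpace Ω] (μ : Measure Ω)
    (R : Set (Set Ω)) (hRcount : R.Countable)
    (hRmeas : ∀ E ∈ R, MeasurableSet E)
    (hRunion : ∀ E ∈ R, ∀ F ∈ R, E ∪ F ∈ R)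
    (hRdiff : ∀ E ∈ R, ∀ F ∈ R, E \ F ∈ R)
    (hRempty : ∅ ∈ R)
    (hRfin : ∀ E ∈ R, μ E < ⊤)
    (hRcover : ⋃₀ R = Set.univ)
    (hRgen : MeasurableSpace.generateFrom R = m)
    (hμ : μ Set.univ = ⊤) :
    ∃ C : ℕ → Set Ω,
      Monotone C ∧
      C 0 = ∅ ∧
      (∀ n, 1 ≤ n → C n ∈ R) ∧
      (∀ n, (2 : ℝ≥0∞) ^ (n + 1) ≤ μ (C (n + 1) \ C n)) ∧
      (⋃ n, C n) = Set.univ ∧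
      (∀ n, 1 ≤ n → C n \ C (n - 1) ∈ R) ∧
      (∀ k l, 1 ≤ k → 1 ≤ l → k ≠ l →
        Disjoint (C k \ C (k - 1)) (C l \ C (l - 1))) ∧
      (∀ n, 1 ≤ n → (2 : ℝ≥0∞) ^ n ≤ μ (C n \ C (n - 1))) ∧
      (⋃ n, C (n + 1) \ C n) = Set.univ := by
  obtain ⟨e, he⟩ := hRcount.exists_eq_range ⟨∅, hRempty⟩
  have heR : ∀ n, e n ∈ R := fun n => he ▸ mem_range_self n
  have hecov : (⋃ n, e n) = Set.univ := by
    rw [← hRcover, he, sUnion_range]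
  have hA : ∀ n, Set.accumulate e n ∈ R := by
    intro n
    induction n with
    | zero => simpa using heR 0
    | succ k ih =>
      rw [Set.accumulate_succ]
      exact hRunion _ ih _ (heR _)
  have hlim : Tendsto (fun n => μ (Set.accumulate e n)) atTop (nhds ⊤) := by
    have := tendsto_measure_iUnion_atTop (μ := μ) (Set.monotone_accumulate (s := e))
    rwa [Set.iUnion_accumulate, hecov, hμ] at this
  have step : ∀ (n : ℕ) (C : R), ∃ C' : R, (C : Set Ω) ⊆ C' ∧ e n ⊆ C' ∧
      (2 : ℝ≥0∞) ^ (n + 1) ≤ μ ((C' : Set Ω) \ C) := by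
    intro n C
    have hfin : (2 : ℝ≥0∞) ^ (n + 1) + μ (C : Set Ω) < ⊤ :=
      ENNReal.add_lt_top.2 ⟨ENNReal.pow_lt_top (by simp), hRfin _ C.2⟩
    obtain ⟨N, hN, hnN⟩ := ((hlim.eventually (lt_mem_nhds hfin)).and
      (eventually_ge_atTop n)).exists
    refine ⟨⟨C ∪ Set.accumulate e N, hRunion _ C.2 _ (hA N)⟩, subset_union_left, ?_, ?_⟩
    · exact (Set.subset_accumulate.trans (Set.monotone_accumulate hnN)).trans subset_union_right
    · have h1 : μ (Set.accumulate e N) - μ (C : Set Ω) ≤ μ (Set.accumulate e N \ C) :=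
        le_measure_sdiff
      refine (ENNReal.le_sub_of_add_le_right (hRfin _ C.2).ne hN.le).trans (h1.trans ?_)
      exact measure_mono (sdiff_subset_sdiff_left subset_union_right)
  choose f hf1 hf2 hf3 using step
  let D : ℕ → R := fun n => Nat.rec ⟨∅, hRempty⟩ f n
  let C : ℕ → Set Ω := fun n => (D n).1
  have hCR : ∀ n, C n ∈ R := fun n => (D n).2
  have hmono : Monotone C := monotone_nat_of_le_succ fun n => hf1 n (D n)
  have hmeas : ∀ n, (2 : ℝ≥0∞) ^ (n + 1) ≤ μ (C (n + 1) \ C n) := fun n => hf3 n (D n)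
  have hcov : (⋃ n, C n) = Set.univ := by
    refine eq_univ_of_univ_subset ?_
    rw [← hecov]
    exact iUnion_subset fun n => (hf2 n (D n)).trans (subset_iUnion C (n + 1))
  have hdisj : ∀ k l, 1 ≤ k → k < l → Disjoint (C k \ C (k - 1)) (C l \ C (l - 1)) := by
    intro k l _ hkl
    rw [Set.disjoint_left]
    intro x hx hx'
    exact hx'.2 (hmono (by omega : k ≤ l - 1) hx.1)
  refine ⟨C, hmono, rfl, fun n _ => hCR n, hmeas, hcov, fun n _ => hRdiff _ (hCR _) _ (hCR _),
    ?_, ?_, ?_⟩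
  · intro k l hk hl hkl
    rcases lt_or_gt_of_ne hkl with h | h
    · exact hdisj k l hk h
    · exact (hdisj l k hl h).symm
  · intro n hn
    obtain ⟨k, rfl⟩ := Nat.exists_eq_add_of_le' hn
    exact hmeas k
  · refine eq_univ_of_forall fun x => ?_
    classical
    have hx : ∃ n, x ∈ C n := by
      have : x ∈ ⋃ n, C n := hcov ▸ mem_univ x
      simpa using this
    have h0 : Nat.find hx ≠ 0 := by
      intro h
      have h2 := Nat.find_spec hx
      rw [h] at h2
      exact h2
    obtain ⟨k, hk⟩ := Nat.exists_eq_succ_of_ne_zero h0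
    refine mem_iUnion.2 ⟨k, ?_, Nat.find_min hx (by omega)⟩
    have h2 := Nat.find_spec hx
    rwa [hk] at h2
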